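/- arXiv:1610.07662 — 5 statements merged into one kernel-verified Lean document; each statement's English description precedes it below -/
import Mathlib

section
/- Let W be a d-dimensional Gaussian random vector with mean 0 and covariance matrix Λ. Then Wᵀ W is chi-square distributed with r degrees of freedom if and only if Λ is an orthogonal projection matrix (Λ² = Λ, Λᵀ = Λ) of rank r. -/
open Matrix MeasureTheory ProbabilityTheory

/-- A measure on `ℝ^d` is Gaussian with mean `μ` and covariance `Λ` if every linear
functional of it is a one-dimensional Gaussian with the corresponding mean and variance
(Cramér–Wold characterization). -/
def IsGaussianVec {d : ℕ} (ν : Measure (Fin d → ℝ)) (μ : Fin d → ℝ)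
    (Λ : Matrix (Fin d) (Fin d) ℝ) : Prop :=
  ∀ t : Fin d → ℝ, ν.map (fun x => t ⬝ᵥ x) = gaussianReal (t ⬝ᵥ μ) (Real.toNNReal (t ⬝ᵥ (Λ *ᵥ t)))

/-- The chi-square distribution with `r` degrees of freedom: the law of the sum of squares
of `r` i.i.d. standard normals. -/
noncomputable def chiSq (r : ℕ) : Measure ℝ :=
  (Measure.pi fun _ : Fin r => gaussianReal 0 1).map (fun x => ∑ i, (x i) ^ 2)

/-- Laplace/Fourier transform of the square of a standard normal. -/
noncomputable def phiSq (c : ℂ) : ℂ := ∫ z : ℝ, Complex.exp (c * (z : ℂ) ^ 2) ∂(gaussianReal 0 1)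

lemma phiSq_zero : phiSq 0 = 1 := by simp [phiSq]

lemma phiSq_neg (s : ℝ) (hs : 0 ≤ s) : phiSq (-(s : ℂ)) = (((√(1 + 2 * s))⁻¹ : ℝ) : ℂ) := by
  have h1 : phiSq (-(s : ℂ)) = ((∫ z : ℝ, Real.exp (-s * z ^ 2) ∂(gaussianReal 0 1) : ℝ) : ℂ) := by
    rw [phiSq, ← integral_complex_ofReal]
    congr with z
    push_cast
    rfl
  rw [h1]
  congr 1
  rw [integral_gaussianReal_eq_integral_smul one_ne_zero]
  have h2 : ∀ z : ℝ, gaussianPDFReal 0 1 z • Real.exp (-s * z ^ 2)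
      = (√(2 * Real.pi))⁻¹ * Real.exp (-(s + 1 / 2) * z ^ 2) := by
    intro z
    simp only [gaussianPDFReal, smul_eq_mul, mul_assoc, ← Real.exp_add]
    simp
    left
    ring_nf
  simp_rw [h2]
  rw [integral_const_mul, integral_gaussian, ← Real.sqrt_inv, ← Real.sqrt_mul (by positivity),
    ← Real.sqrt_inv]
  congr 1
  have := Real.pi_pos
  field_simp
  ring

lemma phiSq_gaussian (c : ℂ) (v : ℝ) (hv : 0 ≤ v) :
    ∫ z : ℝ, Complex.exp (c * (z : ℂ) ^ 2) ∂(gaussianReal 0 v.toNNReal) = phiSq (c * v) := by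
  have h : gaussianReal 0 v.toNNReal = (gaussianReal 0 1).map (√v * ·) := by
    rw [gaussianReal_map_const_mul]
    congr 1
    · simp
    · ext
      simp [hv]
  rw [h, integral_map (by fun_prop) (by fun_prop), phiSq]
  congr with z
  have : ((√v : ℝ) : ℂ) ^ 2 = v := by
    rw [← Complex.ofReal_pow, Real.sq_sqrt hv]
  push_cast
  rw [mul_pow, this, mul_assoc]

lemma integral_chiSq (r : ℕ) (c : ℂ) :
    ∫ q : ℝ, Complex.exp (c * q) ∂(chiSq r) = phiSq c ^ r := by
  rw [chiSq, integral_map (Measurable.aemeasurable (by fun_prop)) (by fun_prop)]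
  have h : ∀ x : Fin r → ℝ, Complex.exp (c * ((∑ i, (x i) ^ 2 : ℝ) : ℂ))
      = ∏ i, Complex.exp (c * ((x i : ℝ) : ℂ) ^ 2) := by
    intro x
    rw [← Complex.exp_sum]
    push_cast
    rw [Finset.mul_sum]
  simp_rw [h]
  rw [integral_fintype_prod_eq_prod (fun _ : Fin r => fun z : ℝ => Complex.exp (c * (z : ℂ) ^ 2))]
  simp [phiSq]

lemma map_pi_gauss {d : ℕ} (Λ U : Matrix (Fin d) (Fin d) ℝ) (lam : Fin d → ℝ)
    (hlam : ∀ i, 0 ≤ lam i) (hU : Uᵀ * Λ * U = diagonal lam)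
    (ν : Measure (Fin d → ℝ)) [IsProbabilityMeasure ν] (hν : IsGaussianVec ν 0 Λ) :
    ν.map (fun x => Uᵀ *ᵥ x) = Measure.pi (fun i => gaussianReal 0 (lam i).toNNReal) := by
  have hm : Measurable (fun x : Fin d → ℝ => Uᵀ *ᵥ x) := by
    have : Continuous (fun x : Fin d → ℝ => Uᵀ *ᵥ x) := by fun_prop
    exact this.measurable
  have := Measure.isProbabilityMeasure_map (μ := ν) hm.aemeasurable
  apply Measure.ext_of_charFunDual
  ext L
  rw [charFunDual_pi]
  simp_rw [charFunDual_eq_charFun_map_one]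
  set ℓ : Fin d → ℝ := fun i => L (Pi.single i 1) with hℓ
  have hL : ∀ y, L y = ℓ ⬝ᵥ y := by
    intro y
    conv_lhs => rw [← Finset.univ_sum_single y]
    rw [map_sum, dotProduct]
    refine Finset.sum_congr rfl fun i _ => ?_
    have : (Pi.single i (y i) : Fin d → ℝ) = y i • Pi.single i 1 := by
      rw [← Pi.single_smul]; simp
    rw [this, map_smul, smul_eq_mul, mul_comm]
  have h1 : (ν.map (fun x => Uᵀ *ᵥ x)).map L = ν.map (fun x => (U *ᵥ ℓ) ⬝ᵥ x) := by
    rw [Measure.map_map (by fun_prop) hm]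
    congr 1
    ext x
    simp only [Function.comp, hL]
    rw [dotProduct_mulVec, vecMul_transpose]
  have h2 : (U *ᵥ ℓ) ⬝ᵥ (Λ *ᵥ (U *ᵥ ℓ)) = ∑ i, lam i * ℓ i ^ 2 := by
    have : (U *ᵥ ℓ) ⬝ᵥ (Λ *ᵥ (U *ᵥ ℓ)) = ℓ ⬝ᵥ ((Uᵀ * Λ * U) *ᵥ ℓ) := by
      rw [← mulVec_mulVec, ← mulVec_mulVec, dotProduct_mulVec ℓ, vecMul_transpose]
    rw [this, hU, dotProduct]
    refine Finset.sum_congr rfl fun i _ => ?_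
    rw [mulVec_diagonal]; ring
  have h3 : ∀ i, (gaussianReal 0 (lam i).toNNReal).map (L.comp (.single ℝ (fun _ : Fin d => ℝ) i))
      = (gaussianReal 0 (lam i).toNNReal).map (ℓ i * ·) := by
    intro i
    congr 1
    ext y
    simp [hL]
  rw [h1, hν, h2, charFun_gaussianReal]
  simp_rw [h3, gaussianReal_map_const_mul, charFun_gaussianReal]
  rw [← Complex.exp_sum]
  congr 1
  have h4 : 0 ≤ ∑ i, lam i * ℓ i ^ 2 :=
    Finset.sum_nonneg fun i _ => mul_nonneg (hlam i) (sq_nonneg _)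
  simp [h4, hlam, Finset.sum_div, neg_div]
  refine Finset.sum_congr rfl fun i _ => ?_
  ring

lemma integral_quad {d : ℕ} (Λ U : Matrix (Fin d) (Fin d) ℝ) (lam : Fin d → ℝ)
    (hlam : ∀ i, 0 ≤ lam i) (hU : Uᵀ * Λ * U = diagonal lam) (hU2 : U * Uᵀ = 1)
    (ν : Measure (Fin d → ℝ)) [IsProbabilityMeasure ν] (hν : IsGaussianVec ν 0 Λ) (c : ℂ) :
    ∫ q : ℝ, Complex.exp (c * q) ∂(ν.map (fun x => x ⬝ᵥ x)) = ∏ i, phiSq (c * lam i) := by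
  have hm : Measurable (fun x : Fin d → ℝ => Uᵀ *ᵥ x) := by
    have : Continuous (fun x : Fin d → ℝ => Uᵀ *ᵥ x) := by fun_prop
    exact this.measurable
  have hs : Measurable (fun x : Fin d → ℝ => x ⬝ᵥ x) := by
    unfold dotProduct; fun_prop
  have h0 : ν.map (fun x => x ⬝ᵥ x)
      = (Measure.pi (fun i => gaussianReal 0 (lam i).toNNReal)).map (fun x => x ⬝ᵥ x) := by
    rw [← map_pi_gauss Λ U lam hlam hU ν hν, Measure.map_map hs hm]
    congr 1
    ext x
    simp only [Function.comp]
    rw [dotProduct_mulVec, vecMul_transpose, mulVec_mulVec, hU2, one_mulVec]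
  rw [h0, integral_map hs.aemeasurable (by fun_prop)]
  have h : ∀ x : Fin d → ℝ, Complex.exp (c * ((x ⬝ᵥ x : ℝ) : ℂ))
      = ∏ i, Complex.exp (c * ((x i : ℝ) : ℂ) ^ 2) := by
    intro x
    rw [← Complex.exp_sum, dotProduct]
    push_cast
    rw [Finset.mul_sum]
    simp_rw [sq]
  simp_rw [h]
  rw [integral_fintype_prod_eq_prod (fun _ : Fin d => fun z : ℝ => Complex.exp (c * (z : ℂ) ^ 2))]
  exact Finset.prod_congr rfl fun i _ => phiSq_gaussian c _ (hlam i)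

lemma poly_step {d r : ℕ} (lam : Fin d → ℝ)
    (h : ∀ s : ℝ, 0 ≤ s → ∏ i, (1 + lam i * s) = (1 + s) ^ r) :
    (∀ i, lam i = 0 ∨ lam i = 1) ∧ (Finset.univ.filter fun i => lam i ≠ 0).card = r := by
  have hp : (∏ i, (1 + Polynomial.C (lam i) * Polynomial.X) : Polynomial ℝ)
      = (1 + Polynomial.X) ^ r := by
    apply Polynomial.eq_of_infinite_eval_eq
    refine (Set.Ici_infinite (0 : ℝ)).mono fun s hs => ?_
    simpa [Polynomial.eval_prod] using h s hs
  have hall : ∀ s : ℝ, ∏ i, (1 + lam i * s) = (1 + s) ^ r := by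
    intro s
    simpa [Polynomial.eval_prod] using congrArg (Polynomial.eval s) hp
  have h01 : ∀ i, lam i = 0 ∨ lam i = 1 := by
    intro i
    by_cases hi : lam i = 0
    · exact Or.inl hi
    right
    have h1 := hall (-(lam i)⁻¹)
    rw [Finset.prod_eq_zero (Finset.mem_univ i) (by field_simp; ring)] at h1
    have h2 := eq_zero_of_pow_eq_zero h1.symm
    field_simp at h2
    linarith
  refine ⟨h01, ?_⟩
  have h1 := hall 1
  have h2 : ∀ i, 1 + lam i * 1 = if lam i ≠ 0 then (2 : ℝ) else 1 := by
    intro i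
    rcases h01 i with h | h <;> simp [h]; norm_num
  simp_rw [h2] at h1
  rw [← Finset.prod_filter, Finset.prod_const] at h1
  norm_num at h1
  exact_mod_cast h1

theorem gaussian_quadform_chiSq_iff (d r : ℕ) (Λ : Matrix (Fin d) (Fin d) ℝ)
    (hΛ : Λ.PosSemidef) (ν : Measure (Fin d → ℝ)) [IsProbabilityMeasure ν]
    (hν : IsGaussianVec ν 0 Λ) :
    ν.map (fun x => x ⬝ᵥ x) = chiSq r ↔ (Λ * Λ = Λ ∧ Λᵀ = Λ ∧ Λ.rank = r) := by
  have hH := hΛ.isHermitian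
  have hT : Λᵀ = Λ := by simpa [conjTranspose_eq_transpose_of_trivial] using hH.eq
  obtain ⟨U, hUdef⟩ : ∃ U : Matrix (Fin d) (Fin d) ℝ, U = hH.eigenvectorUnitary := ⟨_, rfl⟩
  obtain ⟨lam, hlamdef⟩ : ∃ l : Fin d → ℝ, l = hH.eigenvalues := ⟨_, rfl⟩
  have hlam : ∀ i, 0 ≤ lam i := by rw [hlamdef]; exact hΛ.eigenvalues_nonneg
  have hstar : star U = Uᵀ := by
    rw [star_eq_conjTranspose, conjTranspose_eq_transpose_of_trivial]
  have hU2 : U * Uᵀ = 1 := by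
    rw [← hstar, hUdef]; exact Unitary.coe_mul_star_self _
  have hU1 : Uᵀ * U = 1 := mul_eq_one_comm.mp hU2
  have hsp : Λ = U * diagonal lam * Uᵀ := by
    have := hH.spectral_theorem
    rw [Unitary.conjStarAlgAut_apply] at this
    rw [← hstar, hUdef, hlamdef]
    exact this
  have hU : Uᵀ * Λ * U = diagonal lam := by
    rw [hsp]
    calc Uᵀ * (U * diagonal lam * Uᵀ) * U = (Uᵀ * U) * diagonal lam * (Uᵀ * U) := by
          simp only [mul_assoc]
      _ = _ := by rw [hU1]; simp
  have hrank : Λ.rank = (Finset.univ.filter fun i => lam i ≠ 0).card := by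
    rw [hH.rank_eq_card_non_zero_eigs, Fintype.card_subtype, hlamdef]
  have hidem : Λ * Λ = Λ ↔ ∀ i, lam i = 0 ∨ lam i = 1 := by
    have e1 : Λ * Λ = Λ ↔ diagonal lam * diagonal lam = diagonal lam := by
      constructor
      · intro h
        rw [← hU]
        calc Uᵀ * Λ * U * (Uᵀ * Λ * U) = Uᵀ * Λ * (U * Uᵀ) * Λ * U := by simp only [mul_assoc]
          _ = Uᵀ * (Λ * Λ) * U := by rw [hU2]; simp only [mul_one, mul_assoc]
          _ = _ := by rw [h]
      · intro h
        rw [hsp]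
        calc U * diagonal lam * Uᵀ * (U * diagonal lam * Uᵀ)
            = U * diagonal lam * (Uᵀ * U) * diagonal lam * Uᵀ := by simp only [mul_assoc]
          _ = U * (diagonal lam * diagonal lam) * Uᵀ := by rw [hU1]; simp only [mul_one, mul_assoc]
          _ = _ := by rw [h]
    rw [e1, diagonal_mul_diagonal, diagonal_eq_diagonal_iff]
    refine forall_congr' fun i => ?_
    constructor
    · intro h
      have h' : lam i * (lam i - 1) = 0 := by linarith
      rcases mul_eq_zero.mp h' with h | h
      · exact Or.inl h
      · exact Or.inr (by linarith)
    · rintro (h | h) <;> simp [h]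
  have hQ := integral_quad Λ U lam hlam hU hU2 ν hν
  rw [hidem, hrank]
  constructor
  · intro h
    have key : ∀ s : ℝ, 0 ≤ s → ∏ i, (1 + lam i * s) = (1 + s) ^ r := by
      intro s hs
      have h1 := hQ (-((s / 2 : ℝ) : ℂ))
      rw [h, integral_chiSq, phiSq_neg _ (by positivity)] at h1
      have h2 : ∀ i, phiSq (-((s / 2 : ℝ) : ℂ) * lam i) = (((√(1 + lam i * s))⁻¹ : ℝ) : ℂ) := by
        intro i
        have := phiSq_neg (s / 2 * lam i) (mul_nonneg (by positivity) (hlam i))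
        rw [show 1 + lam i * s = 1 + 2 * (s / 2 * lam i) by ring, ← this]
        push_cast
        ring_nf
      simp_rw [h2] at h1
      norm_cast at h1
      have h3 := congrArg (fun x : ℝ => (x ^ 2)⁻¹) h1
      simp only [← Finset.prod_pow, ← Finset.prod_inv_distrib, inv_pow, inv_inv] at h3
      rw [← pow_mul, mul_comm r 2, pow_mul, Real.sq_sqrt (by positivity)] at h3
      rw [show 1 + s = 1 + 2 * (s / 2) by ring, h3]
      refine Finset.prod_congr rfl fun i _ => ?_
      rw [Real.sq_sqrt]
      have := mul_nonneg (hlam i) hs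
      linarith
    obtain ⟨a, b⟩ := poly_step lam key
    exact ⟨a, hT, b⟩
  · rintro ⟨h01, -, hr⟩
    have hs : Measurable (fun x : Fin d → ℝ => x ⬝ᵥ x) := by
      unfold dotProduct; fun_prop
    have := Measure.isProbabilityMeasure_map (μ := ν) hs.aemeasurable
    have : IsProbabilityMeasure (chiSq r) :=
      Measure.isProbabilityMeasure_map (Measurable.aemeasurable (by fun_prop))
    apply Measure.ext_of_charFun
    ext t
    rw [charFun_apply_real, charFun_apply_real]
    have e : ∀ x : ℝ, (t : ℂ) * x * Complex.I = (t * Complex.I) * x := fun x => by ring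
    simp_rw [e]
    rw [hQ, integral_chiSq, ← hr, ← Finset.prod_const, Finset.prod_filter]
    refine Finset.prod_congr rfl fun i _ => ?_
    rcases h01 i with h | h <;> simp [h, phiSq_zero]
end

section
/- Let Y ∼ N(μ, V) be a d-dimensional Gaussian vector and let A, B be symmetric d×d matrices with A V B = 0. Then the quadratic forms Yᵀ A Y and Yᵀ B Y are independent random variables. -/
open Matrix MeasureTheory ProbabilityTheory

/-- Every real square matrix has a generalized inverse. -/
lemma exists_ginv_aux {d : ℕ} (A : Matrix (Fin d) (Fin d) ℝ) :
    ∃ G : Matrix (Fin d) (Fin d) ℝ, A * G * A = A := by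
  let f := Matrix.toLin' A
  obtain ⟨g, hg⟩ := f.rangeRestrict.exists_rightInverse_of_surjective f.range_rangeRestrict
  obtain ⟨h, hh⟩ := LinearMap.exists_extend g
  refine ⟨LinearMap.toMatrix' h, ?_⟩
  apply Matrix.toLin'.injective
  ext1 x
  simp only [Matrix.toLin'_mul, Matrix.toLin'_toMatrix', LinearMap.comp_apply]
  have h1 : h (f (Pi.single x 1)) = g (f.rangeRestrict (Pi.single x 1)) := by
    rw [← hh]; rfl
  have h2 := congrArg Subtype.val
    (LinearMap.congr_fun hg (f.rangeRestrict (Pi.single x 1)))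
  ext1
  simp only [LinearMap.comp_apply, LinearMap.single_apply]
  change f (h (f (Pi.single x 1))) = f (Pi.single x 1)
  rw [h1]
  exact h2

/-- For symmetric `A`, the quadratic form of `A` is a function of `A x`. -/
lemma quad_eq_aux {d : ℕ} (A G : Matrix (Fin d) (Fin d) ℝ) (hA : Aᵀ = A) (hG : A * G * A = A)
    (x : Fin d → ℝ) : x ⬝ᵥ (A *ᵥ x) = (A *ᵥ x) ⬝ᵥ (G *ᵥ (A *ᵥ x)) := by
  conv_lhs => rw [← hG]
  rw [← Matrix.mulVec_mulVec, ← Matrix.mulVec_mulVec, Matrix.dotProduct_mulVec x A,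
    ← Matrix.mulVec_transpose, hA]

/-- Craig's theorem (noncentral version): if `A V B = 0` then the quadratic forms
`Yᵀ A Y` and `Yᵀ B Y` of a Gaussian vector `Y ∼ N(μ, V)` are independent. -/
theorem craig_theorem (d : ℕ) {Ω : Type*} [MeasurableSpace Ω] (Pm : Measure Ω)
    [IsProbabilityMeasure Pm] (Y : Ω → Fin d → ℝ) (hYmeas : Measurable Y)
    (μ : Fin d → ℝ) (V : Matrix (Fin d) (Fin d) ℝ) (hV : V.PosSemidef)
    (hY : IsGaussianVec (Pm.map Y) μ V)
    (A B : Matrix (Fin d) (Fin d) ℝ) (hA : Aᵀ = A) (hB : Bᵀ = B)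
    (hAVB : A * V * B = 0) :
    IndepFun (fun ω => Y ω ⬝ᵥ (A *ᵥ Y ω)) (fun ω => Y ω ⬝ᵥ (B *ᵥ Y ω)) Pm := by
  have hlaw : ∀ t : Fin d → ℝ, Pm.map (fun ω => t ⬝ᵥ Y ω) =
      gaussianReal (t ⬝ᵥ μ) (Real.toNNReal (t ⬝ᵥ (V *ᵥ t))) := by
    intro t
    rw [← hY t, Measure.map_map (by fun_prop) hYmeas]
    rfl
  have hm : ∀ t : Fin d → ℝ, Measurable (fun ω => t ⬝ᵥ Y ω) := by
    intro t
    have : Measurable (fun x : Fin d → ℝ => t ⬝ᵥ x) := by fun_prop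
    exact this.comp hYmeas
  have hnn : ∀ t : Fin d → ℝ, 0 ≤ t ⬝ᵥ (V *ᵥ t) := fun t => by
    simpa using hV.dotProduct_mulVec_nonneg t
  have hvar : ∀ t : Fin d → ℝ, Var[fun ω => t ⬝ᵥ Y ω; Pm] = t ⬝ᵥ (V *ᵥ t) := by
    intro t
    have h := variance_id_gaussianReal (μ := t ⬝ᵥ μ) (v := Real.toNNReal (t ⬝ᵥ (V *ᵥ t)))
    rw [← hlaw t, variance_map (by fun_prop) (hm t).aemeasurable] at h
    simpa [Function.comp_def, Real.coe_toNNReal _ (hnn t)] using h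
  have hL2 : ∀ t : Fin d → ℝ, MemLp (fun ω => t ⬝ᵥ Y ω) 2 Pm := by
    intro t
    have h := memLp_id_gaussianReal' (μ := t ⬝ᵥ μ) (v := Real.toNNReal (t ⬝ᵥ (V *ᵥ t))) 2
      (by norm_num)
    rw [← hlaw t, memLp_map_measure_iff (by fun_prop) (hm t).aemeasurable] at h
    exact h
  have hVs : Vᵀ = V := by simpa using hV.isHermitian.eq
  have hcov : ∀ s t : Fin d → ℝ,
      cov[fun ω => s ⬝ᵥ Y ω, fun ω => t ⬝ᵥ Y ω; Pm] = s ⬝ᵥ (V *ᵥ t) := by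
    intro s t
    have h := variance_add (hL2 s) (hL2 t)
    have e : ((fun ω => s ⬝ᵥ Y ω) + fun ω => t ⬝ᵥ Y ω) = fun ω => (s + t) ⬝ᵥ Y ω := by
      ext ω; simp [add_dotProduct]
    rw [e, hvar, hvar, hvar] at h
    have hsymm : t ⬝ᵥ (V *ᵥ s) = s ⬝ᵥ (V *ᵥ t) := by
      rw [Matrix.dotProduct_mulVec, ← Matrix.mulVec_transpose, hVs, dotProduct_comm]
    rw [Matrix.mulVec_add, add_dotProduct, dotProduct_add, dotProduct_add, hsymm] at h
    linarith
  have hG : HasGaussianLaw Y Pm := by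
    constructor
    constructor
    intro L
    have hLe : ∃ t : Fin d → ℝ, ∀ x, L x = t ⬝ᵥ x := by
      refine ⟨fun i => L (Pi.single i 1), fun x => ?_⟩
      conv_lhs => rw [pi_eq_sum_univ' x]
      simp [dotProduct, mul_comm]
    obtain ⟨t, ht⟩ := hLe
    have hLf : (L : (Fin d → ℝ) → ℝ) = fun x => t ⬝ᵥ x := funext ht
    have hmt : Measurable (fun x : Fin d → ℝ => t ⬝ᵥ x) := by fun_prop
    have hr := hY t
    have hi : ∫ x, t ⬝ᵥ x ∂(Pm.map Y) = t ⬝ᵥ μ := by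
      have h := integral_id_gaussianReal (μ := t ⬝ᵥ μ) (v := Real.toNNReal (t ⬝ᵥ (V *ᵥ t)))
      rw [← hr, integral_map hmt.aemeasurable (by fun_prop)] at h
      exact h
    have hv : Var[fun x => t ⬝ᵥ x; Pm.map Y] = t ⬝ᵥ (V *ᵥ t) := by
      rw [variance_map (by fun_prop) hYmeas.aemeasurable]
      exact hvar t
    rw [hLf, hi, hv, hr]
  have hAB : IndepFun (fun ω => A *ᵥ Y ω) (fun ω => B *ᵥ Y ω) Pm := by
    refine HasGaussianLaw.indepFun_of_covariance_eval
      (X := fun i ω => (A *ᵥ Y ω) i) (Y := fun i ω => (B *ᵥ Y ω) i) ?_ ?_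
    · exact hG.map_fun (((Matrix.toLin' A).prod (Matrix.toLin' B)).toContinuousLinearMap)
    · intro i j
      have h := hcov (A i) (B j)
      have h0 : A i ⬝ᵥ (V *ᵥ B j) = (A * V * B) i j := by
        conv_rhs => rw [← hB, Matrix.mul_assoc]
        rfl
      rw [h0, hAVB] at h
      exact h
  obtain ⟨G, hGA⟩ := exists_ginv_aux A
  obtain ⟨H, hHB⟩ := exists_ginv_aux B
  have hq : ∀ K : Matrix (Fin d) (Fin d) ℝ, Measurable (fun y : Fin d → ℝ => y ⬝ᵥ (K *ᵥ y)) := by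
    intro K
    apply Continuous.measurable
    fun_prop
  have := hAB.comp (hq G) (hq H)
  simp only [quad_eq_aux A G hA hGA, quad_eq_aux B H hB hHB]
  exact this
end

section
/- Let X ∈ ℝ^d with 𝟙ᵀ X = n and p⁰ a probability vector, and let Z ∼ N(0, (1/ρ) I_d). Define U = (X + Z - n p⁰)/√n. Then with Σ_{nρ} = Diag(p⁰) - p⁰(p⁰)ᵀ + (1/(nρ)) I_d and P = I_d - (1/d)𝟙𝟙ᵀ, the random variables Uᵀ P Σ_{nρ}^{-1} P U and (Σ_{i=1}^d Z_i)² are independent. -/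
open Matrix MeasureTheory ProbabilityTheory

theorem gaussVec_hasGaussianLaw {d : ℕ} {Ω : Type*} [MeasurableSpace Ω] (Pm : Measure Ω)
    (Z : Ω → Fin d → ℝ) (μ : Fin d → ℝ) (Λ : Matrix (Fin d) (Fin d) ℝ)
    (hZ : IsGaussianVec (Pm.map Z) μ Λ) : HasGaussianLaw Z Pm := by
  refine ⟨isGaussian_of_map_eq_gaussianReal fun L => ?_⟩
  refine ⟨_, _, (?_ : Measure.map _ _ = _).trans (hZ (fun i => L (Pi.single i 1)))⟩
  congr 1
  ext x
  conv_lhs => rw [pi_eq_sum_univ' x]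
  simp [dotProduct, mul_comm, Pi.single]

theorem gaussVec_variance {d : ℕ} {Ω : Type*} [MeasurableSpace Ω] (Pm : Measure Ω)
    (Z : Ω → Fin d → ℝ) (hZmeas : Measurable Z) (ρ : ℝ) (hρ : 0 < ρ)
    (hZ : IsGaussianVec (Pm.map Z) 0 ((1 / ρ) • (1 : Matrix (Fin d) (Fin d) ℝ)))
    (t : Fin d → ℝ) : Var[fun ω => t ⬝ᵥ Z ω; Pm] = (1 / ρ) * (t ⬝ᵥ t) := by
  have hm : Measurable (fun x : Fin d → ℝ => t ⬝ᵥ x) := by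
    unfold dotProduct; fun_prop
  have h0 : 0 ≤ 1 / ρ * (t ⬝ᵥ t) :=
    mul_nonneg (by positivity) (Finset.sum_nonneg fun i _ => mul_self_nonneg _)
  have h := hZ t
  rw [Measure.map_map hm hZmeas] at h
  have h2 := variance_id_map (μ := Pm) (X := (fun x : Fin d → ℝ => t ⬝ᵥ x) ∘ Z)
    (hm.comp hZmeas).aemeasurable
  rw [h, variance_id_gaussianReal, Matrix.smul_mulVec, Matrix.one_mulVec, dotProduct_smul,
    smul_eq_mul, Real.coe_toNNReal _ h0] at h2
  exact h2.symm

theorem gaussVec_covariance {d : ℕ} {Ω : Type*} [MeasurableSpace Ω] (Pm : Measure Ω)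
    [IsProbabilityMeasure Pm]
    (Z : Ω → Fin d → ℝ) (hZmeas : Measurable Z) (ρ : ℝ) (hρ : 0 < ρ)
    (hZ : IsGaussianVec (Pm.map Z) 0 ((1 / ρ) • (1 : Matrix (Fin d) (Fin d) ℝ)))
    (s t : Fin d → ℝ) :
    cov[fun ω => s ⬝ᵥ Z ω, fun ω => t ⬝ᵥ Z ω; Pm] = (1 / ρ) * (s ⬝ᵥ t) := by
  have hG := gaussVec_hasGaussianLaw Pm Z _ _ hZ
  have hL : ∀ t : Fin d → ℝ, MemLp (fun ω => t ⬝ᵥ Z ω) 2 Pm := by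
    intro t
    unfold dotProduct
    exact memLp_finsetSum _ fun i _ => (hG.eval i).memLp_two.const_mul _
  have h := variance_fun_add (hL s) (hL t)
  simp_rw [← add_dotProduct] at h
  rw [gaussVec_variance Pm Z hZmeas ρ hρ hZ, gaussVec_variance Pm Z hZmeas ρ hρ hZ,
    gaussVec_variance Pm Z hZmeas ρ hρ hZ, add_dotProduct, dotProduct_add, dotProduct_add,
    dotProduct_comm t s] at h
  linarith

theorem projected_statistic_indep_noise (d : ℕ) (hd : 0 < d) {Ω : Type*}
    [MeasurableSpace Ω] (Pm : Measure Ω) [IsProbabilityMeasure Pm]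
    (Z : Ω → Fin d → ℝ) (hZmeas : Measurable Z) (ρ : ℝ) (hρ : 0 < ρ)
    (hZ : IsGaussianVec (Pm.map Z) 0 ((1 / ρ) • (1 : Matrix (Fin d) (Fin d) ℝ)))
    (n : ℝ) (hn : 0 < n) (X : Fin d → ℝ) (hX : ∑ i, X i = n)
    (p : Fin d → ℝ) (hp0 : ∀ i, 0 ≤ p i) (hp1 : ∑ i, p i = 1) :
    let Snρ : Matrix (Fin d) (Fin d) ℝ :=
      Matrix.diagonal p - Matrix.vecMulVec p p + (1 / (n * ρ)) • (1 : Matrix (Fin d) (Fin d) ℝ)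
    let P : Matrix (Fin d) (Fin d) ℝ :=
      1 - (1 / (d : ℝ)) • Matrix.vecMulVec (fun _ => 1) (fun _ => 1)
    let U : Ω → Fin d → ℝ := fun ω i => (X i + Z ω i - n * p i) / Real.sqrt n
    IndepFun (fun ω => U ω ⬝ᵥ ((P * Snρ⁻¹ * P) *ᵥ U ω)) (fun ω => (∑ i, Z ω i) ^ 2) Pm := by
  intro Snρ P U
  have hG := gaussVec_hasGaussianLaw Pm Z _ _ hZ
  have hPt : Pᵀ = P := by
    ext i j
    simp [P, Matrix.vecMulVec_apply, Matrix.one_apply, eq_comm]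
  have hP1 : ∀ i, P i ⬝ᵥ (fun _ => (1 : ℝ)) = 0 := by
    intro i
    have : (d : ℝ) ≠ 0 := by positivity
    simp [P, dotProduct, Matrix.vecMulVec_apply, Matrix.one_apply, Finset.sum_sub_distrib, this]
  have hI : IndepFun (fun ω (i : Fin d) => P i ⬝ᵥ Z ω)
      (fun ω (_ : Unit) => (fun _ => (1 : ℝ)) ⬝ᵥ Z ω) Pm := by
    refine HasGaussianLaw.indepFun_of_covariance_eval (X := fun i ω => P i ⬝ᵥ Z ω)
      (Y := fun (_ : Unit) ω => (fun _ => (1 : ℝ)) ⬝ᵥ Z ω) ?_ fun i j => ?_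
    · let L1 : (Fin d → ℝ) →ₗ[ℝ] (Fin d → ℝ) := Matrix.mulVecLin P
      let L2 : (Fin d → ℝ) →ₗ[ℝ] (Unit → ℝ) :=
        Matrix.mulVecLin (Matrix.of fun (_ : Unit) (_ : Fin d) => (1 : ℝ))
      exact hG.map_fun (LinearMap.toContinuousLinearMap (L1.prod L2))
    · rw [gaussVec_covariance Pm Z hZmeas ρ hρ hZ, hP1, mul_zero]
  let c : Fin d → ℝ := P *ᵥ (fun i => X i - n * p i)
  have hI2 := hI.comp
    (φ := fun v => ((Real.sqrt n)⁻¹ • (c + v)) ⬝ᵥ (Snρ⁻¹ *ᵥ ((Real.sqrt n)⁻¹ • (c + v))))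
    (ψ := fun u => (u ()) ^ 2)
    (by unfold dotProduct Matrix.mulVec dotProduct; fun_prop) (by fun_prop)
  convert hI2 using 1
  · ext ω
    have hU : (Real.sqrt n)⁻¹ • (c + P *ᵥ Z ω) = P *ᵥ U ω := by
      rw [← Matrix.mulVec_add, ← Matrix.mulVec_smul]
      congr 1
      ext i
      simp [U]
      ring
    change _ = ((Real.sqrt n)⁻¹ • (c + P *ᵥ Z ω)) ⬝ᵥ
      (Snρ⁻¹ *ᵥ ((Real.sqrt n)⁻¹ • (c + P *ᵥ Z ω)))
    rw [hU, ← Matrix.mulVec_mulVec, ← Matrix.mulVec_mulVec, Matrix.dotProduct_mulVec,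
      ← Matrix.mulVec_transpose, hPt]
  · ext ω
    simp [dotProduct]
end

section
/- Let U ∼ N(0, Σ) where Σ = Diag(p⁰) - p⁰(p⁰)ᵀ for a probability vector p⁰ with positive entries. Then Σ_{i=1}^d U_i²/p_i⁰ is chi-square distributed with d-1 degrees of freedom. -/
open Matrix MeasureTheory ProbabilityTheory

theorem pearson_chiSq (d : ℕ) (hd : 0 < d) (p : Fin d → ℝ)
    (hp0 : ∀ i, 0 < p i) (hp1 : ∑ i, p i = 1)
    (ν : Measure (Fin d → ℝ)) [IsProbabilityMeasure ν]
    (hν : IsGaussianVec ν 0 (Matrix.diagonal p - Matrix.vecMulVec p p)) :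
    ν.map (fun x => ∑ i, (x i) ^ 2 / p i) = chiSq (d - 1) := by
  obtain ⟨n, rfl⟩ : ∃ n, d = n + 1 := ⟨d - 1, by omega⟩
  rw [Nat.add_sub_cancel]
  let s : (EuclideanSpace ℝ (Fin (n + 1))) := WithLp.toLp 2 (fun i => √(p i))
  have hsi : ∀ i, s i = √(p i) := fun i => rfl
  have hs1 : ‖s‖ = 1 := by
    rw [EuclideanSpace.norm_eq, Real.sqrt_eq_one]
    simp only [hsi, Real.norm_eq_abs, sq_abs, Real.sq_sqrt (hp0 _).le, hp1]
  have hs0 : s ≠ 0 := by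
    intro h
    rw [h, norm_zero] at hs1
    exact zero_ne_one hs1
  let F : Submodule ℝ (EuclideanSpace ℝ (Fin (n + 1))) := (Submodule.span ℝ {s})ᗮ
  have hfact : Fact (Module.finrank ℝ (EuclideanSpace ℝ (Fin (n + 1))) = n + 1) := ⟨by simp⟩
  have hF : Module.finrank ℝ F = n := Submodule.finrank_orthogonal_span_singleton hs0
  let b : OrthonormalBasis (Fin n) ℝ F :=
    (stdOrthonormalBasis ℝ F).reindex (finCongr hF)
  let f : (Fin (n + 1) → ℝ) → (EuclideanSpace ℝ (Fin (n + 1))) := fun x => WithLp.toLp 2 (fun i => x i / √(p i))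
  have hf : Measurable f := by
    show Measurable (fun x : Fin (n + 1) → ℝ => WithLp.toLp 2 (fun i => x i / √(p i)))
    fun_prop
  have hsub : Measurable (F.subtypeL : F → (EuclideanSpace ℝ (Fin (n + 1)))) := F.subtypeL.continuous.measurable
  have key : ν.map f = (stdGaussian F).map F.subtypeL := by
    have : IsProbabilityMeasure (ν.map f) := Measure.isProbabilityMeasure_map hf.aemeasurable
    have : IsProbabilityMeasure ((stdGaussian F).map F.subtypeL) :=
      Measure.isProbabilityMeasure_map hsub.aemeasurable
    apply Measure.ext_of_charFun
    ext t
    -- the standard Gaussian side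
    have h2 : charFun ((stdGaussian F).map F.subtypeL) t
        = charFun (stdGaussian F) (F.orthogonalProjectionOnto t) := by
      rw [charFun_apply, integral_map hsub.aemeasurable (by fun_prop), charFun_apply]
      congr 1
      ext x
      congr 3
      simp
    have hn : ‖F.orthogonalProjectionOnto t‖ ^ 2 = ‖t‖ ^ 2 - (inner ℝ s t) ^ 2 := by
      have h := Submodule.norm_sq_eq_add_norm_sq_projection t (Submodule.span ℝ {s})
      have h3 : ‖(Submodule.span ℝ {s}).orthogonalProjectionOnto t‖ = |inner ℝ s t| := by
        rw [← Submodule.norm_coe, ← Submodule.starProjection_apply,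
          Submodule.starProjection_unit_singleton ℝ hs1, norm_smul, hs1, mul_one, Real.norm_eq_abs]
      rw [h3, sq_abs] at h
      show ‖(Submodule.span ℝ {s})ᗮ.orthogonalProjectionOnto t‖ ^ 2 = _
      linarith
    -- the ν side
    let u : Fin (n + 1) → ℝ := fun i => t i / √(p i)
    have hum : Measurable (fun x : Fin (n + 1) → ℝ => u ⬝ᵥ x) :=
      (continuous_const.dotProduct continuous_id).measurable
    have h1 : charFun (ν.map f) t = charFun (ν.map (fun x => u ⬝ᵥ x)) 1 := by
      rw [charFun_apply, integral_map hf.aemeasurable (by fun_prop), charFun_apply,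
        integral_map hum.aemeasurable (by fun_prop)]
      congr 1
      ext x
      congr 3
      simp [f, u, PiLp.inner_apply, dotProduct]
      refine Finset.sum_congr rfl fun i _ => ?_
      ring
    have hv : u ⬝ᵥ ((Matrix.diagonal p - Matrix.vecMulVec p p) *ᵥ u)
        = ‖t‖ ^ 2 - (inner ℝ s t) ^ 2 := by
      have ha : u ⬝ᵥ (Matrix.diagonal p *ᵥ u) = ‖t‖ ^ 2 := by
        rw [EuclideanSpace.norm_sq_eq]
        simp only [dotProduct, Matrix.mulVec_diagonal, u, Real.norm_eq_abs, sq_abs]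
        refine Finset.sum_congr rfl fun i _ => ?_
        have := hp0 i
        have hq := Real.sqrt_pos.2 this
        have h5 := Real.sq_sqrt this.le
        field_simp
        rw [h5]
      have hb : p ⬝ᵥ u = inner ℝ s t := by
        simp only [PiLp.inner_apply, dotProduct, u]
        refine Finset.sum_congr rfl fun i _ => ?_
        have := hp0 i
        have hq := Real.sqrt_pos.2 this
        have h5 := Real.sq_sqrt this.le
        simp [hsi]
        field_simp
        rw [h5]
        ring
      rw [Matrix.sub_mulVec, dotProduct_sub, ha, Matrix.vecMulVec_mulVec, hb]
      have hc : u ⬝ᵥ p = inner ℝ s t := by rw [dotProduct_comm, hb]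
      simp [hc]
      ring
    rw [h1, h2, hν u, charFun_gaussianReal, charFun_stdGaussian, hv, ← hn]
    rw [Real.coe_toNNReal _ (by positivity)]
    congr 1
    simp
    ring
  have hcomp : (fun x : Fin (n + 1) → ℝ => ∑ i, (x i) ^ 2 / p i) = (fun y : (EuclideanSpace ℝ (Fin (n + 1))) => ‖y‖ ^ 2) ∘ f := by
    ext x
    simp only [Function.comp, EuclideanSpace.norm_sq_eq, f, Real.norm_eq_abs, sq_abs, div_pow,
      Real.sq_sqrt (hp0 _).le]
  have hmn : Measurable (fun y : (EuclideanSpace ℝ (Fin (n + 1))) => ‖y‖ ^ 2) := by fun_prop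
  rw [hcomp, ← Measure.map_map hmn hf, key, Measure.map_map hmn hsub,
    stdGaussian_eq_map_pi_orthonormalBasis b,
    Measure.map_map (hmn.comp hsub) (by fun_prop), chiSq]
  congr 1
  ext x
  have : ∑ i, x i • b i = b.repr.symm (WithLp.toLp 2 x) := by
    rw [← b.sum_repr_symm]
  simp only [Function.comp, this, Submodule.subtypeL_apply, Submodule.norm_coe,
    LinearIsometryEquiv.norm_map, EuclideanSpace.norm_sq_eq, Real.norm_eq_abs, sq_abs]
end

section
/- Let p⁰ be a probability vector with positive entries and ρ > 0. Set Σ_ρ = Diag(p⁰) - p⁰(p⁰)ᵀ + (1/ρ)I_d and P = I_d - (1/d)𝟙𝟙ᵀ. Then the matrix Λ = Σ_ρ^{-1/2} P Σ_ρ P Σ_ρ^{-1/2} is idempotent, symmetric, and has rank d-1. Consequently, for U ∼ N(0, Σ_ρ), the quadratic form Uᵀ P Σ_ρ^{-1} P U is chi-square distributed with d-1 degrees of freedom. -/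
open Matrix MeasureTheory ProbabilityTheory

lemma std_pi_of_forall {n : ℕ} (μ : Measure (Fin n → ℝ)) [IsProbabilityMeasure μ]
    (h : ∀ t : Fin n → ℝ, μ.map (fun x => t ⬝ᵥ x) = gaussianReal 0 (Real.toNNReal (t ⬝ᵥ t))) :
    μ = Measure.pi fun _ : Fin n => gaussianReal 0 1 := by
  rw [← charFun_eq_pi_iff]
  intro t
  have h1 : charFun (μ.map (WithLp.toLp 2)) t
      = charFun (μ.map (fun x => t.ofLp ⬝ᵥ x)) 1 := by
    rw [charFun_apply, charFun_apply, ← MeasurableEquiv.coe_toLp, integral_map_equiv,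
      integral_map]
    · simp [PiLp.inner_apply, dotProduct]
    · exact Measurable.aemeasurable (by unfold dotProduct; fun_prop)
    · exact Measurable.aestronglyMeasurable (by fun_prop)
  have hnn : 0 ≤ t.ofLp ⬝ᵥ t.ofLp := by
    unfold dotProduct
    exact Finset.sum_nonneg fun i _ => mul_self_nonneg _
  rw [h1, h]
  simp only [charFun_gaussianReal]
  rw [← Complex.exp_sum]
  congr 1
  rw [Real.coe_toNNReal _ hnn]
  simp [dotProduct, Finset.sum_div, pow_two]

lemma exists_half (n : ℕ) : ∃ A : Matrix (Fin n) (Fin (n+1)) ℝ, A * Aᵀ = 1 ∧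
    Aᵀ * A = 1 - (1 / ((n+1 : ℕ) : ℝ)) • Matrix.vecMulVec (fun _ => 1) (fun _ => 1) := by
  let c : ℝ := (Real.sqrt ((n+1 : ℕ) : ℝ))⁻¹
  have hc : c * c = 1 / ((n+1 : ℕ) : ℝ) := by
    simp only [c]
    rw [← mul_inv, Real.mul_self_sqrt (by positivity), one_div]
  let v : Fin (n+1) → EuclideanSpace ℝ (Fin (n+1)) := fun _ => WithLp.toLp 2 (fun _ => c)
  have hv : Orthonormal ℝ (({0} : Set (Fin (n+1))).domRestrict v) := by
    refine ⟨fun i => ?_, fun i j hij => ?_⟩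
    · have : ‖(WithLp.toLp 2 (fun _ => c) : EuclideanSpace ℝ (Fin (n+1)))‖ ^ 2 = 1 := by
        rw [EuclideanSpace.real_norm_sq_eq]
        simp only [Finset.sum_const, Finset.card_univ, Fintype.card_fin, nsmul_eq_mul, pow_two, hc]
        field_simp
      have h2 : ‖(WithLp.toLp 2 (fun _ => c) : EuclideanSpace ℝ (Fin (n+1)))‖ = 1 := by
        exact (pow_eq_one_iff_of_nonneg (norm_nonneg _) two_ne_zero).mp this
      exact h2
    · exact absurd (Subsingleton.elim i j) hij
  obtain ⟨b, hb⟩ := hv.exists_orthonormalBasis_extension_of_card_eq (by simp)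
  have hb0 : b 0 = WithLp.toLp 2 (fun _ => c) := hb 0 rfl
  let B : Matrix (Fin (n+1)) (Fin (n+1)) ℝ := Matrix.of fun i j => b i j
  have hB : B * Bᵀ = 1 := by
    ext i j
    have := orthonormal_iff_ite.mp b.orthonormal j i
    rw [PiLp.inner_apply] at this
    simp only [RCLike.inner_apply, conj_trivial] at this
    simp only [Matrix.mul_apply, Matrix.transpose_apply, B, Matrix.of_apply, Matrix.one_apply]
    rw [this]
    simp [eq_comm]
  have hB' : Bᵀ * B = 1 := mul_eq_one_comm.mp hB
  refine ⟨Matrix.of fun i j => B i.succ j, ?_, ?_⟩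
  · ext i j
    have := congrFun (congrFun hB i.succ) j.succ
    simp only [Matrix.mul_apply, Matrix.transpose_apply, Matrix.one_apply, Fin.succ_inj] at this
    simpa [Matrix.mul_apply, Matrix.one_apply] using this
  · ext i j
    have := congrFun (congrFun hB' i) j
    rw [Matrix.mul_apply, Fin.sum_univ_succ] at this
    have e : ∀ k, B 0 k = c := fun k => by simp [B, hb0]
    simp only [Matrix.transpose_apply, e, hc] at this
    rw [Matrix.sub_apply, ← this]
    simp [Matrix.mul_apply, vecMulVec_apply]

lemma sum_sq_eq {n : ℕ} (x : Fin n → ℝ) : ∑ i, (x i)^2 = x ⬝ᵥ x := by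
  simp [dotProduct, pow_two]

theorem projected_statistic_chiSq (d : ℕ) (hd : 0 < d) (p : Fin d → ℝ)
    (hp0 : ∀ i, 0 < p i) (hp1 : ∑ i, p i = 1) (ρ : ℝ) (hρ : 0 < ρ)
    (S : Matrix (Fin d) (Fin d) ℝ) (hS : S.PosDef)
    (hSsq : S * S =
      Matrix.diagonal p - Matrix.vecMulVec p p + (1 / ρ) • (1 : Matrix (Fin d) (Fin d) ℝ)) :
    let Sρ : Matrix (Fin d) (Fin d) ℝ :=
      Matrix.diagonal p - Matrix.vecMulVec p p + (1 / ρ) • (1 : Matrix (Fin d) (Fin d) ℝ)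
    let P : Matrix (Fin d) (Fin d) ℝ :=
      1 - (1 / (d : ℝ)) • Matrix.vecMulVec (fun _ => 1) (fun _ => 1)
    let Λ : Matrix (Fin d) (Fin d) ℝ := S⁻¹ * P * Sρ * P * S⁻¹
    (Λ * Λ = Λ ∧ Λᵀ = Λ ∧ Λ.rank = d - 1) ∧
    ∀ (ν : Measure (Fin d → ℝ)), IsProbabilityMeasure ν → IsGaussianVec ν 0 Sρ →
      ν.map (fun x => x ⬝ᵥ ((P * Sρ⁻¹ * P) *ᵥ x)) = chiSq (d - 1) := by
  obtain ⟨n, rfl⟩ : ∃ n, d = n + 1 := ⟨d - 1, by omega⟩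
  intro Sρ P Λ
  have hSS : S * S = Sρ := hSsq
  have hSt : Sᵀ = S := by simpa using hS.isHermitian.eq
  have hSu : IsUnit S.det := (Matrix.isUnit_iff_isUnit_det _).mp hS.isUnit
  obtain ⟨A, hA1, hA2⟩ := exists_half n
  have hA2 : Aᵀ * A = P := hA2
  let o : Fin (n+1) → ℝ := fun _ => 1
  let c : ℝ := Real.sqrt (1 / ρ)
  have hcpos : 0 < c := Real.sqrt_pos.mpr (by positivity)
  have hcc : c * c = 1 / ρ := Real.mul_self_sqrt (by positivity)
  have hSρo : Sρ *ᵥ o = (1 / ρ) • o := by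
    ext i
    simp [Sρ, o, Matrix.add_mulVec, Matrix.sub_mulVec, Matrix.smul_mulVec, Matrix.mulVec_diagonal,
      Matrix.vecMulVec_mulVec, dotProduct, hp1]
  have hSo : S *ᵥ o = c • o := by
    have hpd : (S + c • (1 : Matrix (Fin (n+1)) (Fin (n+1)) ℝ)).PosDef :=
      hS.add (Matrix.PosDef.one.smul hcpos)
    have hz : (S + c • (1 : Matrix (Fin (n+1)) (Fin (n+1)) ℝ)) *ᵥ (S *ᵥ o - c • o) = 0 := by
      rw [Matrix.add_mulVec, Matrix.mulVec_sub, Matrix.mulVec_sub, Matrix.mulVec_mulVec, hSS, hSρo,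
        ← hcc]
      simp only [Matrix.smul_mulVec, Matrix.one_mulVec, Matrix.mulVec_smul]
      module
    have := Matrix.eq_zero_of_mulVec_eq_zero hpd.det_pos.ne' hz
    exact sub_eq_zero.mp this
  have hoS : o ᵥ* S = c • o := by
    rw [← hSo, ← Matrix.vecMul_transpose, hSt]
  have hcomm : S * P = P * S := by
    have : P = 1 - (1 / ((n+1 : ℕ) : ℝ)) • Matrix.vecMulVec o o := rfl
    rw [this, Matrix.mul_sub, Matrix.sub_mul, Matrix.mul_smul, Matrix.smul_mul,
      Matrix.mul_vecMulVec, Matrix.vecMulVec_mul, hSo, hoS, Matrix.smul_vecMulVec,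
      Matrix.vecMulVec_smul]
    simp
  have hi1 : S⁻¹ * S = 1 := Matrix.nonsing_inv_mul _ hSu
  have hi2 : S * S⁻¹ = 1 := Matrix.mul_nonsing_inv _ hSu
  have hcomm' : S⁻¹ * P = P * S⁻¹ := by
    calc S⁻¹ * P = S⁻¹ * P * (S * S⁻¹) := by rw [hi2, Matrix.mul_one]
      _ = S⁻¹ * (P * S) * S⁻¹ := by simp only [Matrix.mul_assoc]
      _ = (S⁻¹ * S) * P * S⁻¹ := by rw [← hcomm]; simp only [Matrix.mul_assoc]
      _ = P * S⁻¹ := by rw [hi1, Matrix.one_mul]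
  have hPP : P * P = P := by
    rw [← hA2]
    calc Aᵀ * A * (Aᵀ * A) = Aᵀ * (A * Aᵀ) * A := by simp only [Matrix.mul_assoc]
      _ = _ := by rw [hA1, Matrix.mul_one]
  have hPt : Pᵀ = P := by rw [← hA2]; simp
  have hΛ : Λ = P := by
    calc Λ = S⁻¹ * P * Sρ * P * S⁻¹ := rfl
      _ = P * (S⁻¹ * S) * (S * P) * S⁻¹ := by
          rw [hcomm', ← hSS]; simp only [Matrix.mul_assoc]
      _ = (P * P) * (S * S⁻¹) := by
          rw [hi1, hcomm]; simp only [Matrix.mul_assoc, Matrix.one_mul]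
      _ = P := by rw [hi2, hPP, Matrix.mul_one]
  have hrank : P.rank = n := by
    rw [← hA2, Matrix.rank_transpose_mul_self, ← Matrix.rank_self_mul_transpose, hA1,
      Matrix.rank_one, Fintype.card_fin]
  refine ⟨⟨by rw [hΛ, hPP], by rw [hΛ, hPt], by rw [hΛ, hrank]; simp⟩, ?_⟩
  intro ν hν hG
  have hinv : Sρ⁻¹ = S⁻¹ * S⁻¹ := by rw [← hSS, Matrix.mul_inv_rev]
  have hSit : (S⁻¹)ᵀ = S⁻¹ := by rw [Matrix.transpose_nonsing_inv, hSt]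
  have hQ : P * Sρ⁻¹ * P = (A * S⁻¹)ᵀ * (A * S⁻¹) := by
    rw [Matrix.transpose_mul, hSit]
    calc P * Sρ⁻¹ * P = P * S⁻¹ * (S⁻¹ * P) := by rw [hinv]; simp only [Matrix.mul_assoc]
      _ = S⁻¹ * (P * P) * S⁻¹ := by
        rw [← hcomm', hcomm', ← hcomm']; nth_rewrite 2 [hcomm']; simp only [Matrix.mul_assoc]
      _ = _ := by rw [hPP, ← hA2]; simp only [Matrix.mul_assoc]
  have hmeas : Measurable (fun x : Fin (n+1) → ℝ => (A * S⁻¹) *ᵥ x) := by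
    unfold Matrix.mulVec dotProduct
    fun_prop
  have hstd : ν.map (fun x => (A * S⁻¹) *ᵥ x) = Measure.pi fun _ : Fin n => gaussianReal 0 1 := by
    have : IsProbabilityMeasure (ν.map (fun x => (A * S⁻¹) *ᵥ x)) :=
      Measure.isProbabilityMeasure_map hmeas.aemeasurable
    apply std_pi_of_forall
    intro t
    rw [Measure.map_map (by unfold dotProduct; fun_prop) hmeas]
    have h1 := hG (t ᵥ* (A * S⁻¹))
    have hv : (t ᵥ* (A * S⁻¹)) ⬝ᵥ (Sρ *ᵥ (t ᵥ* (A * S⁻¹))) = t ⬝ᵥ t := by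
      rw [← Matrix.mulVec_transpose (A * S⁻¹) t, Matrix.mulVec_mulVec, Matrix.mulVec_transpose,
        ← Matrix.dotProduct_mulVec, Matrix.mulVec_mulVec]
      have : A * S⁻¹ * (Sρ * (A * S⁻¹)ᵀ) = 1 := by
        rw [Matrix.transpose_mul, hSit, ← hSS]
        calc A * S⁻¹ * (S * S * (S⁻¹ * Aᵀ)) = A * (S⁻¹ * S) * (S * S⁻¹) * Aᵀ := by
              simp only [Matrix.mul_assoc]
          _ = 1 := by rw [hi1, hi2, Matrix.mul_one, Matrix.mul_one, hA1]
      rw [this, Matrix.one_mulVec]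
    rw [hv, dotProduct_zero] at h1
    rw [← h1]
    congr 1
    ext x
    simp only [Function.comp_apply]
    rw [Matrix.dotProduct_mulVec]
  have hfun : (fun x : Fin (n+1) → ℝ => x ⬝ᵥ ((P * Sρ⁻¹ * P) *ᵥ x))
      = (fun y : Fin n → ℝ => ∑ i, (y i)^2) ∘ (fun x => (A * S⁻¹) *ᵥ x) := by
    ext x
    simp only [Function.comp_apply]
    rw [sum_sq_eq, hQ, ← Matrix.mulVec_mulVec, Matrix.dotProduct_mulVec, Matrix.vecMul_transpose]
  rw [hfun, ← Measure.map_map (by fun_prop) hmeas, hstd]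
  rfl
end
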